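/- arXiv:2505.17644 — 3 statements merged into one kernel-verified Lean document; each statement's English description precedes it below -/
import Mathlib

section
/- Let x, y ∈ ℝⁿ be distinct points and let M ≥ ‖x−y‖. If s* ∈ X_M is a minimizer of I[s] = ∫₀¹ ‖s(t) − y‖² dt over X_M, then the geometric trajectory {s*(t) : t ∈ [0,1]} equals the straight line segment connecting y and x, i.e., the image of s* equals the set { (1−u)·y + u·x : u ∈ [0,1] }. -/
open MeasureTheory intervalIntegral

/-- Any minimizer of `I[s] = ∫₀¹ ‖s(t) − y‖² dt` over `X_M`
has as its geometric trajectory exactly the straight line segment from `y` to `x`. -/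
theorem image_of_minimizer_eq_segment {n : ℕ}
    (x y : EuclideanSpace ℝ (Fin n)) (hxy : x ≠ y)
    (M : ℝ) (hM : ‖x - y‖ ≤ M)
    (s : ℝ → EuclideanSpace ℝ (Fin n))
    (hs : LipschitzOnWith M.toNNReal s (Set.Icc 0 1))
    (hs0 : s 0 = y) (hs1 : s 1 = x)
    (hmin : ∀ s' : ℝ → EuclideanSpace ℝ (Fin n),
      LipschitzOnWith M.toNNReal s' (Set.Icc 0 1) → s' 0 = y → s' 1 = x →
      (∫ t in (0:ℝ)..1, ‖s t - y‖ ^ 2) ≤ ∫ t in (0:ℝ)..1, ‖s' t - y‖ ^ 2) :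
    s '' Set.Icc (0 : ℝ) 1 = {z | ∃ u ∈ Set.Icc (0 : ℝ) 1, z = (1 - u) • y + u • x} := by
  have hL : 0 < ‖x - y‖ := norm_pos_iff.mpr (sub_ne_zero.mpr hxy)
  set L := ‖x - y‖ with hLdef
  have hM0 : 0 < M := lt_of_lt_of_le hL hM
  have hMc : ((M.toNNReal : NNReal) : ℝ) = M := Real.coe_toNNReal M hM0.le
  set φ : ℝ → ℝ := fun t => max 0 (L - M * (1 - t)) with hφ
  have hφ0 : ∀ t, 0 ≤ φ t := fun t => le_max_left _ _
  set p : ℝ → EuclideanSpace ℝ (Fin n) := fun t => y + (φ t / L) • (x - y) with hp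
  have hpn : ∀ t, ‖p t - y‖ = φ t := by
    intro t
    simp only [hp, add_sub_cancel_left, norm_smul, Real.norm_eq_abs]
    rw [abs_of_nonneg (div_nonneg (hφ0 t) hL.le), ← hLdef, div_mul_cancel₀ _ hL.ne']
  have hp0 : p 0 = y := by
    have : φ 0 = 0 := by simp only [hφ]; exact max_eq_left (by linarith)
    simp [hp, this]
  have hp1 : p 1 = x := by
    have : φ 1 = L := by simp only [hφ]; rw [max_eq_right] <;> linarith
    simp [hp, this, div_self hL.ne']
  have hplip : LipschitzOnWith M.toNNReal p (Set.Icc 0 1) := by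
    apply LipschitzOnWith.of_dist_le_mul
    intro a _ b _
    rw [hMc, dist_eq_norm, Real.dist_eq]
    have e : p a - p b = ((φ a - φ b) / L) • (x - y) := by
      simp only [hp]; module
    rw [e, norm_smul, ← hLdef, Real.norm_eq_abs, abs_div, abs_of_pos hL, div_mul_cancel₀ _ hL.ne']
    have h1 : |φ a - φ b| ≤ |(L - M * (1 - a)) - (L - M * (1 - b))| :=
      by simpa [hφ] using abs_max_sub_max_le_max (0:ℝ) (L - M * (1 - a)) 0 (L - M * (1 - b))
    refine h1.trans (le_of_eq ?_)
    rw [show (L - M * (1 - a)) - (L - M * (1 - b)) = M * (a - b) by ring, abs_mul, abs_of_pos hM0]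
  have hxs : ∀ t ∈ Set.Icc (0:ℝ) 1, ‖x - s t‖ ≤ M * (1 - t) := by
    intro t ht
    have h := hs.dist_le_mul 1 (by simp) t ht
    rwa [hs1, hMc, dist_eq_norm, Real.dist_eq, abs_of_nonneg (by linarith [ht.2])] at h
  have hlow : ∀ t ∈ Set.Icc (0:ℝ) 1, φ t ≤ ‖s t - y‖ := by
    intro t ht
    refine max_le (norm_nonneg _) ?_
    have := norm_add_le (x - s t) (s t - y)
    rw [sub_add_sub_cancel] at this
    linarith [hxs t ht]
  have heq : ∀ t ∈ Set.Icc (0:ℝ) 1, ‖s t - y‖ = φ t := by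
    by_contra! hcon
    obtain ⟨c, hc, hne⟩ := hcon
    have hlt := intervalIntegral.integral_lt_integral_of_continuousOn_of_le_of_exists_lt
      (f := fun t => ‖p t - y‖ ^ 2) (g := fun t => ‖s t - y‖ ^ 2) (a := 0) (b := 1) one_pos
      (((hplip.continuousOn.sub continuousOn_const).norm).pow 2)
      (((hs.continuousOn.sub continuousOn_const).norm).pow 2)
      (by
        intro t ht
        simp only [hpn]
        exact pow_le_pow_left₀ (hφ0 t) (hlow t ⟨ht.1.le, ht.2⟩) 2)
      ⟨c, hc, by
        simp only [hpn]
        exact pow_lt_pow_left₀ (lt_of_le_of_ne (hlow c hc) hne.symm) (hφ0 c) two_ne_zero⟩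
    exact absurd (hmin p hplip hp0 hp1) (not_le.mpr hlt)
  have hsp : ∀ t ∈ Set.Icc (0:ℝ) 1, s t = p t := by
    intro t ht
    have ha := heq t ht
    rcases le_total (L - M * (1 - t)) 0 with h | h
    · have h0 : φ t = 0 := max_eq_left h
      rw [h0, norm_eq_zero, sub_eq_zero] at ha
      simp [hp, h0, ha]
    · have h0 : φ t = L - M * (1 - t) := max_eq_right h
      have hb : ‖(x - y) - (s t - y)‖ ≤ L - φ t := by
        rw [sub_sub_sub_cancel_right, h0]; linarith [hxs t ht]
      have hsq := norm_sub_sq_real (x - y) (s t - y)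
      have hcs := real_inner_le_norm (x - y) (s t - y)
      have hin : inner ℝ (x - y) (s t - y) = ‖x - y‖ * ‖s t - y‖ := by
        refine le_antisymm hcs ?_
        have := pow_le_pow_left₀ (norm_nonneg _) hb 2
        rw [hsq, ha, ← hLdef] at this
        rw [ha, ← hLdef]
        nlinarith
      rw [inner_eq_norm_mul_iff_real, ha, ← hLdef] at hin
      have : s t - y = (φ t / L) • (x - y) := by
        rw [div_eq_inv_mul, mul_smul, hin, smul_smul, inv_mul_cancel₀ hL.ne', one_smul]
      simp only [hp]
      rw [← this]; abel
  ext z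
  constructor
  · rintro ⟨t, ht, rfl⟩
    refine ⟨φ t / L, ⟨div_nonneg (hφ0 t) hL.le, (div_le_one hL).mpr ?_⟩, ?_⟩
    · exact max_le hL.le (by nlinarith [ht.2])
    · rw [hsp t ht]; simp only [hp]; module
  · rintro ⟨u, hu, rfl⟩
    have h1 : 0 ≤ L * (1 - u) / M := div_nonneg (mul_nonneg hL.le (by linarith [hu.2])) hM0.le
    have h2 : L * (1 - u) / M ≤ 1 := (div_le_one hM0).mpr (by nlinarith [hu.1])
    have ht : 1 - L * (1 - u) / M ∈ Set.Icc (0:ℝ) 1 := ⟨by linarith, by linarith⟩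
    refine ⟨_, ht, ?_⟩
    rw [hsp _ ht]
    have h3 : φ (1 - L * (1 - u) / M) = L * u := by
      have : L - M * (1 - (1 - L * (1 - u) / M)) = L * u := by field_simp; ring
      simp only [hφ, this]
      exact max_eq_right (mul_nonneg hL.le hu.1)
    simp only [hp]
    rw [h3, mul_div_cancel_left₀ _ hL.ne']
    module
end

section
/- Let x, y ∈ ℝⁿ be distinct points and let M ≥ ‖x−y‖. Let I denote the straight line segment { (1−u)·y + u·x : u ∈ [0,1] }, let proj_I be the metric projection onto I, and for s ∈ X_M let q(t) = proj_I(s(t)). If the set T = { t ∈ [0,1] : s(t) ∉ I } has positive Lebesgue measure, then ∫₀¹ ‖q(t) − y‖² dt < ∫₀¹ ‖s(t) − y‖² dt; that is, the projected path strictly decreases the functional I[s] = ∫₀¹ ‖s(t) − y‖² dt. -/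
open MeasureTheory intervalIntegral

/-- if a path `s ∈ X_M` leaves the segment `[y, x]` on a set of times of
positive Lebesgue measure, then projecting it onto the segment strictly decreases the
functional `I[s] = ∫₀¹ ‖s(t) − y‖² dt`. -/
theorem projection_strictly_decreases_cost {n : ℕ}
    (x y : EuclideanSpace ℝ (Fin n)) (hxy : x ≠ y)
    (M : ℝ) (hM : ‖x - y‖ ≤ M)
    (proj : EuclideanSpace ℝ (Fin n) → EuclideanSpace ℝ (Fin n))
    (hproj : ∀ z, proj z ∈ {w | ∃ u ∈ Set.Icc (0:ℝ) 1, w = (1 - u) • y + u • x} ∧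
      ∀ w ∈ {w | ∃ u ∈ Set.Icc (0:ℝ) 1, w = (1 - u) • y + u • x}, ‖z - proj z‖ ≤ ‖z - w‖)
    (s : ℝ → EuclideanSpace ℝ (Fin n))
    (hs : LipschitzOnWith M.toNNReal s (Set.Icc 0 1))
    (hs0 : s 0 = y) (hs1 : s 1 = x)
    (hT : 0 < volume {t ∈ Set.Icc (0:ℝ) 1 |
      s t ∉ {w | ∃ u ∈ Set.Icc (0:ℝ) 1, w = (1 - u) • y + u • x}}) :
    (∫ t in (0:ℝ)..1, ‖proj (s t) - y‖ ^ 2) < ∫ t in (0:ℝ)..1, ‖s t - y‖ ^ 2 := by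
  have hseg : {w | ∃ u ∈ Set.Icc (0:ℝ) 1, w = (1 - u) • y + u • x} = segment ℝ y x := by
    rw [segment_eq_image]
    ext w
    simp only [Set.mem_setOf_eq, Set.mem_image, eq_comm]
  rw [hseg] at hproj hT
  have hvar : ∀ z, ∀ w ∈ segment ℝ y x, inner ℝ (z - proj z) (w - proj z) ≤ 0 := by
    intro z
    rw [← norm_eq_iInf_iff_real_inner_le_zero (convex_segment y x) (hproj z).1]
    haveI : Nonempty (segment ℝ y x) := ⟨⟨proj z, (hproj z).1⟩⟩
    apply le_antisymm
    · exact le_ciInf fun w => (hproj z).2 w w.2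
    · exact ciInf_le (f := fun w : segment ℝ y x => ‖z - w‖)
        ⟨0, by rintro _ ⟨w, rfl⟩; exact norm_nonneg _⟩ ⟨proj z, (hproj z).1⟩
  have hpyth : ∀ z, ‖proj z - y‖ ^ 2 + ‖z - proj z‖ ^ 2 ≤ ‖z - y‖ ^ 2 := by
    intro z
    have h1 := hvar z y (left_mem_segment ℝ y x)
    have h2 : z - y = (z - proj z) - (y - proj z) := by abel
    rw [h2, norm_sub_sq_real (z - proj z) (y - proj z), norm_sub_rev (proj z) y]
    linarith
  have hlip : LipschitzWith 1 proj := by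
    apply LipschitzWith.of_dist_le_mul
    intro a b
    rw [dist_eq_norm, dist_eq_norm, NNReal.coe_one, one_mul]
    have h1 := hvar a _ (hproj b).1
    have h2 := hvar b _ (hproj a).1
    have h3 : ‖proj a - proj b‖ ^ 2 = inner ℝ (a - b) (proj a - proj b)
        + inner ℝ (a - proj a) (proj b - proj a) + inner ℝ (b - proj b) (proj a - proj b) := by
      rw [← real_inner_self_eq_norm_sq]
      simp only [inner_sub_left, inner_sub_right]
      ring
    have h4 := real_inner_le_norm (a - b) (proj a - proj b)
    by_contra! hc
    nlinarith [norm_nonneg (a - b), norm_nonneg (proj a - proj b)]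
  have hsc := hs.continuousOn
  apply integral_lt_integral_of_continuousOn_of_le_of_exists_lt one_pos
  · exact ((((hlip.continuous.comp_continuousOn hsc).sub continuousOn_const).norm).pow 2)
  · exact ((hsc.sub continuousOn_const).norm).pow 2
  · intro t _
    nlinarith [hpyth (s t), sq_nonneg ‖s t - proj (s t)‖]
  · obtain ⟨t, ht, hts⟩ := nonempty_of_measure_ne_zero hT.ne'
    refine ⟨t, ht, ?_⟩
    have hne : s t - proj (s t) ≠ 0 := by
      intro h
      rw [sub_eq_zero] at h
      exact hts (h ▸ (hproj (s t)).1)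
    have := pow_pos (norm_pos_iff.2 hne) 2
    linarith [hpyth (s t)]
end

section
/- Let x, y ∈ ℝⁿ be distinct points, let M ≥ ‖x−y‖, and let I denote the straight line segment { (1−u)·y + u·x : u ∈ [0,1] } with metric projection proj_I. If s* ∈ X_M minimizes the functional I[s] = ∫₀¹ ‖s(t) − y‖² dt over X_M, then for Lebesgue-almost every t ∈ [0,1] one has s*(t) ∈ I; that is, the set { t ∈ [0,1] : s*(t) ∉ I } has Lebesgue measure zero. -/
open MeasureTheory intervalIntegral

/-- clamp to the unit interval -/
noncomputable def clampU (r : ℝ) : ℝ := max 0 (min 1 r)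

lemma clampU_lip (a b : ℝ) : |clampU a - clampU b| ≤ |a - b| := by
  unfold clampU
  refine (abs_max_sub_max_le_max _ _ _ _).trans ?_
  simp only [sub_self, abs_zero]
  refine max_le (abs_nonneg _) ((abs_min_sub_min_le_max _ _ _ _).trans ?_)
  simp

lemma clampU_mem (a : ℝ) : clampU a ∈ Set.Icc (0:ℝ) 1 := by
  unfold clampU
  exact ⟨le_max_left _ _, max_le zero_le_one (min_le_left _ _)⟩

lemma clampU_var (a : ℝ) : 0 ≤ clampU a * (a - clampU a) := by
  unfold clampU
  rcases le_total a 0 with h | h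
  · rw [max_eq_left ((min_le_right _ _).trans h)]; simp
  · rw [max_eq_right (le_min zero_le_one h)]
    exact mul_nonneg (le_min zero_le_one h) (sub_nonneg.2 (min_le_right _ _))

/-- projection onto the segment from y to x -/
noncomputable def segP {n : ℕ} (x y z : EuclideanSpace ℝ (Fin n)) : EuclideanSpace ℝ (Fin n) :=
  y + clampU (inner ℝ (z - y) (x - y) / ‖x - y‖ ^ 2) • (x - y)

lemma segP_lip {n : ℕ} (x y : EuclideanSpace ℝ (Fin n)) (hxy : x ≠ y) :
    LipschitzWith 1 (segP x y) := by
  have hd : 0 < ‖x - y‖ := norm_pos_iff.2 (sub_ne_zero.2 hxy)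
  refine LipschitzWith.of_dist_le_mul fun z w => ?_
  rw [dist_eq_norm, dist_eq_norm]
  unfold segP
  rw [add_sub_add_left_eq_sub, ← sub_smul, norm_smul, Real.norm_eq_abs]
  have h1 := clampU_lip (inner ℝ (z - y) (x - y) / ‖x - y‖ ^ 2)
    (inner ℝ (w - y) (x - y) / ‖x - y‖ ^ 2)
  rw [← sub_div, ← inner_sub_left, sub_sub_sub_cancel_right, abs_div,
    abs_of_pos (pow_pos hd 2)] at h1
  have h2 := abs_real_inner_le_norm (z - w) (x - y)
  calc _ ≤ |inner ℝ (z - w) (x - y)| / ‖x - y‖ ^ 2 * ‖x - y‖ := by gcongr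
    _ ≤ ‖z - w‖ * ‖x - y‖ / ‖x - y‖ ^ 2 * ‖x - y‖ := by gcongr
    _ = _ := by
      push_cast
      field_simp

lemma segP_pyth {n : ℕ} (x y z : EuclideanSpace ℝ (Fin n)) (hxy : x ≠ y) :
    ‖segP x y z - y‖ ^ 2 + ‖z - segP x y z‖ ^ 2 ≤ ‖z - y‖ ^ 2 := by
  have hd : 0 < ‖x - y‖ := norm_pos_iff.2 (sub_ne_zero.2 hxy)
  have h := clampU_var (inner ℝ (z - y) (x - y) / ‖x - y‖ ^ 2)
  have e : inner ℝ (z - y) (x - y) = inner ℝ (z - y) (x - y) / ‖x - y‖ ^ 2 * ‖x - y‖ ^ 2 := by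
    field_simp
  unfold segP
  rw [add_sub_cancel_left, ← sub_sub, norm_sub_sq_real (z - y), inner_smul_right, norm_smul,
    mul_pow, Real.norm_eq_abs, sq_abs]
  set r := inner ℝ (z - y) (x - y) / ‖x - y‖ ^ 2
  rw [e]
  nlinarith [mul_nonneg h (sq_nonneg ‖x - y‖)]

/-- a minimizer `s*` of `I[s] = ∫₀¹ ‖s(t) − y‖² dt` over `X_M` lies on
the segment `[y, x]` for Lebesgue-almost every `t ∈ [0,1]`: the set of times at which
it leaves the segment has measure zero. -/
theorem minimizer_ae_on_segment {n : ℕ}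
    (x y : EuclideanSpace ℝ (Fin n)) (hxy : x ≠ y)
    (M : ℝ) (hM : ‖x - y‖ ≤ M)
    (s : ℝ → EuclideanSpace ℝ (Fin n))
    (hs : LipschitzOnWith M.toNNReal s (Set.Icc 0 1))
    (hs0 : s 0 = y) (hs1 : s 1 = x)
    (hmin : ∀ s' : ℝ → EuclideanSpace ℝ (Fin n),
      LipschitzOnWith M.toNNReal s' (Set.Icc 0 1) → s' 0 = y → s' 1 = x →
      (∫ t in (0:ℝ)..1, ‖s t - y‖ ^ 2) ≤ ∫ t in (0:ℝ)..1, ‖s' t - y‖ ^ 2) :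
    volume {t ∈ Set.Icc (0:ℝ) 1 |
      s t ∉ {w | ∃ u ∈ Set.Icc (0:ℝ) 1, w = (1 - u) • y + u • x}} = 0 := by
  have hP := segP_lip x y hxy
  have hd : 0 < ‖x - y‖ := norm_pos_iff.2 (sub_ne_zero.2 hxy)
  have hq : LipschitzOnWith M.toNNReal (fun t => segP x y (s t)) (Set.Icc 0 1) := by
    have := (hP.lipschitzOnWith (s := Set.univ)).comp hs (Set.mapsTo_univ _ _)
    simpa [Function.comp_def] using this
  have h01 : Set.uIcc (0:ℝ) 1 = Set.Icc 0 1 := Set.uIcc_of_le zero_le_one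
  have key := hmin (fun t => segP x y (s t)) hq
    (by simp [hs0, segP, clampU])
    (by
      simp only [hs1, segP, real_inner_self_eq_norm_sq]
      rw [div_self (pow_pos hd 2).ne']
      simp [clampU])
  have hsc := hs.continuousOn
  have hqc := hq.continuousOn
  have i1 : IntervalIntegrable (fun t => ‖s t - y‖ ^ 2) volume 0 1 :=
    ContinuousOn.intervalIntegrable (by rw [h01]; fun_prop)
  have i2 : IntervalIntegrable (fun t => ‖segP x y (s t) - y‖ ^ 2) volume 0 1 :=
    ContinuousOn.intervalIntegrable (by rw [h01]; exact ((hqc.sub continuousOn_const).norm.pow 2))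
  have i3 : IntervalIntegrable (fun t => ‖s t - segP x y (s t)‖ ^ 2) volume 0 1 :=
    ContinuousOn.intervalIntegrable (by rw [h01]; exact ((hsc.sub hqc).norm.pow 2))
  have hle := intervalIntegral.integral_mono_on zero_le_one (i2.add i3) i1
    (fun t _ => segP_pyth x y (s t) hxy)
  rw [intervalIntegral.integral_add i2 i3] at hle
  have hnn : 0 ≤ ∫ t in (0:ℝ)..1, ‖s t - segP x y (s t)‖ ^ 2 :=
    intervalIntegral.integral_nonneg zero_le_one (fun t _ => by positivity)
  have hz : ∫ t in (0:ℝ)..1, ‖s t - segP x y (s t)‖ ^ 2 = 0 := by linarith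
  rw [intervalIntegral.integral_eq_zero_iff_of_le_of_nonneg_ae zero_le_one
    (Filter.Eventually.of_forall fun t => by positivity) i3,
    restrict_Ioc_eq_restrict_Icc, Filter.EventuallyEq, ae_restrict_iff' measurableSet_Icc,
    ae_iff] at hz
  refine measure_mono_null ?_ hz
  rintro t ⟨ht, hns⟩
  intro hh
  have h0 := hh ht
  simp only [Pi.zero_apply, ne_eq, OfNat.ofNat_ne_zero, not_false_eq_true, pow_eq_zero_iff,
    norm_eq_zero, sub_eq_zero] at h0
  refine hns ⟨_, clampU_mem (inner ℝ (s t - y) (x - y) / ‖x - y‖ ^ 2), h0.trans ?_⟩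
  unfold segP
  module
end
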